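/- arXiv:2201.04973 — 3 statements merged into one kernel-verified Lean document; each statement's English description precedes it below -/
import Mathlib

section
/- For all integers l, h ≥ 0 with N = l + h ≥ 2, the misère-play destined-coins game with an extra genuine coin DM^+_{l,h} is a P-position (a loss for the player to move under optimal play) if and only if N = 2. -/
/-!
A model of the counterfeit-coin weighing games.

There are `n` coins, indexed by `Fin n`, exactly one of which is counterfeit;
all genuine coins weigh the same, and the counterfeit is lighter or heavier
than a genuine coin according to its `FakeType`.  Each coin carries a
`CoinStatus` recording the Observer's knowledge about it:

* `excluded`: the Observer knows the coin is genuine;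
* `light`   : destined to be lighter (if this coin is the counterfeit, it is lighter);
* `heavy`   : destined to be heavier (if this coin is the counterfeit, it is heavier);
* `unknown` : the coin could be the counterfeit, either lighter or heavier.

Both players know the counterfeit coin and its type, and alternately perform
weighings: two disjoint sets of coins of equal size are put on the two pans of a
balance scale, and the outcome is determined by the truth.  After a balanced
weighing, the coins on the scale become excluded.  After an unbalanced weighing,
the coins off the scale become excluded; a coin on the lighter pan becomes
light-destined unless this contradicts its previous status (a heavy-destined
coin on the lighter pan becomes excluded); symmetrically for the heavier pan;
excluded coins stay excluded.  A weighing is legal iff the Observer gains some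
new information, i.e. some coin changes status.

`Found P` says the Observer has found the counterfeit coin (exactly one coin is
not excluded); `FoundAndIdentified P` says she has moreover identified it as
lighter or heavier.  In the game whose end condition is a goal `goal`, play
stops as soon as the goal is reached (`GMove goal`).  `NormalWin` is the
normal-play winning predicate for the player to move (the player unable to move
loses, so the player making the last legal weighing wins); `MisereWin` is the
misère-play winning predicate (the player whose weighing reveals the full
information, i.e. moves to a goal position, loses); `grundy` is the Grundy
(nim-)value: the `mex` of the Grundy values of the options, a position without
options having Grundy value `0`.  Since every legal weighing strictly decreases
the total hidden information `info P`, defining these by recursion with fuel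
`info P` gives the correct values.
-/

/-- The Observer's knowledge about one coin. -/
inductive CoinStatus : Type
  | excluded : CoinStatus
  | light    : CoinStatus
  | heavy    : CoinStatus
  | unknown  : CoinStatus
  deriving DecidableEq

/-- Whether the counterfeit coin is actually lighter or heavier than a genuine coin. -/
inductive FakeType : Type
  | light : FakeType
  | heavy : FakeType
  deriving DecidableEq

/-- The destiny status corresponding to the true type of the counterfeit coin. -/
def FakeType.destiny : FakeType → CoinStatus
  | FakeType.light => CoinStatus.light
  | FakeType.heavy => CoinStatus.heavy

/-- A position of the game: the statuses of the coins (the Observer's knowledge)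
together with the identity and the true type of the counterfeit coin (which both
players know). -/
structure Position (n : ℕ) : Type where
  status : Fin n → CoinStatus
  counterfeit : Fin n
  fakeType : FakeType

/-- Possible outcomes of a weighing. -/
inductive Outcome : Type
  | balanced | leftLighter | rightLighter
  deriving DecidableEq

/-- The truthful outcome of weighing pan `A` (left) against pan `B` (right):
it is determined by the location and the type of the counterfeit coin. -/
def outcome {n : ℕ} (P : Position n) (A B : Finset (Fin n)) : Outcome :=
  if P.counterfeit ∈ A then
    (match P.fakeType with
      | FakeType.light => Outcome.leftLighter
      | FakeType.heavy => Outcome.rightLighter)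
  else if P.counterfeit ∈ B then
    (match P.fakeType with
      | FakeType.light => Outcome.rightLighter
      | FakeType.heavy => Outcome.leftLighter)
  else Outcome.balanced

/-- New status of a coin that lay on the lighter pan of an unbalanced weighing. -/
def onLighterPan : CoinStatus → CoinStatus
  | CoinStatus.excluded => CoinStatus.excluded
  | CoinStatus.heavy => CoinStatus.excluded
  | _ => CoinStatus.light

/-- New status of a coin that lay on the heavier pan of an unbalanced weighing. -/
def onHeavierPan : CoinStatus → CoinStatus
  | CoinStatus.excluded => CoinStatus.excluded
  | CoinStatus.light => CoinStatus.excluded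
  | _ => CoinStatus.heavy

/-- The statuses after weighing `A` against `B`. -/
def updateStatus {n : ℕ} (P : Position n) (A B : Finset (Fin n)) (i : Fin n) :
    CoinStatus :=
  match outcome P A B with
  | Outcome.balanced =>
      if i ∈ A ∨ i ∈ B then CoinStatus.excluded else P.status i
  | Outcome.leftLighter =>
      if i ∈ A then onLighterPan (P.status i)
      else if i ∈ B then onHeavierPan (P.status i)
      else CoinStatus.excluded
  | Outcome.rightLighter =>
      if i ∈ B then onLighterPan (P.status i)
      else if i ∈ A then onHeavierPan (P.status i)
      else CoinStatus.excluded

/-- The position obtained from `P` by weighing pan `A` against pan `B`. -/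
def weigh {n : ℕ} (P : Position n) (A B : Finset (Fin n)) : Position n :=
  ⟨updateStatus P A B, P.counterfeit, P.fakeType⟩

/-- `Move P Q`: `Q` is obtained from `P` by one legal weighing, i.e. the two
pans are disjoint and carry equally many coins, and the Observer gains some new
information (some coin changes status). -/
def Move {n : ℕ} (P Q : Position n) : Prop :=
  ∃ A B : Finset (Fin n), Disjoint A B ∧ A.card = B.card ∧
    updateStatus P A B ≠ P.status ∧ Q = weigh P A B

/-- The set of coins currently having status `s`. -/
def statusSet {n : ℕ} (P : Position n) (s : CoinStatus) : Finset (Fin n) :=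
  Finset.univ.filter fun i => P.status i = s

/-- The set of coins not yet known to be genuine. -/
def nonExcluded {n : ℕ} (P : Position n) : Finset (Fin n) :=
  Finset.univ.filter fun i => P.status i ≠ CoinStatus.excluded

/-- The number of unknown coins. -/
def unknownCount {n : ℕ} (P : Position n) : ℕ :=
  (statusSet P CoinStatus.unknown).card

/-- The number of destined coins. -/
def destinedCount {n : ℕ} (P : Position n) : ℕ :=
  (statusSet P CoinStatus.light).card + (statusSet P CoinStatus.heavy).card

/-- The number of coins sharing the counterfeit coin's status, counting the
counterfeit coin itself. -/
def sameDestinyCount {n : ℕ} (P : Position n) : ℕ :=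
  (Finset.univ.filter fun i => P.status i = P.status P.counterfeit).card

/-- The Observer has found the counterfeit coin: exactly one coin is not excluded. -/
def Found {n : ℕ} (P : Position n) : Prop := (nonExcluded P).card = 1

/-- The Observer has found the counterfeit coin and knows whether it is lighter
or heavier. -/
def FoundAndIdentified {n : ℕ} (P : Position n) : Prop :=
  Found P ∧ P.status P.counterfeit ≠ CoinStatus.unknown

/-- Moves in the game whose end condition is `goal`: the game stops as soon as
the Observer's goal is reached, so no further weighings happen after that. -/
def GMove {n : ℕ} (goal : Position n → Prop) (P Q : Position n) : Prop :=
  ¬ goal P ∧ Move P Q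

/-- The amount of information about one coin still hidden from the Observer. -/
def statusWeight : CoinStatus → ℕ
  | CoinStatus.excluded => 0
  | CoinStatus.unknown => 2
  | _ => 1

/-- The total information still hidden from the Observer.  Every legal weighing
strictly decreases it, so it bounds the number of remaining moves. -/
def info {n : ℕ} (P : Position n) : ℕ := ∑ i, statusWeight (P.status i)

/-- Normal-play winning predicate, computed with fuel. -/
def NormalWinAux {n : ℕ} (moveRel : Position n → Position n → Prop) :
    ℕ → Position n → Prop
  | 0, _ => False
  | k + 1, P => ∃ Q, moveRel P Q ∧ ¬ NormalWinAux moveRel k Q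

/-- The player to move wins under normal play: a player who has no legal move
loses (so the player making the last legal weighing wins).  The fuel `info P`
suffices since every legal weighing strictly decreases `info`. -/
def NormalWin {n : ℕ} (moveRel : Position n → Position n → Prop)
    (P : Position n) : Prop :=
  NormalWinAux moveRel (info P) P

/-- Misère-play winning predicate, computed with fuel. -/
def MisereWinAux {n : ℕ} (moveRel : Position n → Position n → Prop)
    (goal : Position n → Prop) : ℕ → Position n → Prop
  | 0, P => goal P
  | k + 1, P => goal P ∨ ∃ Q, moveRel P Q ∧ ¬ MisereWinAux moveRel goal k Q

/-- The player to move wins under misère play: the player whose weighing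
reveals the full information to the Observer (i.e. moves to a position
satisfying `goal`) loses; equivalently, the player to move at a goal position
has already won.  A position is a P-position iff `MisereWin` fails there. -/
def MisereWin {n : ℕ} (moveRel : Position n → Position n → Prop)
    (goal : Position n → Prop) (P : Position n) : Prop :=
  MisereWinAux moveRel goal (info P) P

/-- Minimum excludant of a set of naturals. -/
noncomputable def mex (s : Set ℕ) : ℕ := sInf {k : ℕ | k ∉ s}

/-- Grundy values, computed with fuel. -/
noncomputable def grundyAux {n : ℕ} (moveRel : Position n → Position n → Prop) :
    ℕ → Position n → ℕ
  | 0, _ => 0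
  | k + 1, P => mex {g : ℕ | ∃ Q, moveRel P Q ∧ grundyAux moveRel k Q = g}

/-- The Grundy (nim-)value of a position: the `mex` of the Grundy values of the
positions reachable in one legal move; a position with no legal move has Grundy
value `0`.  The fuel `info P` suffices since every legal weighing strictly
decreases `info`. -/
noncomputable def grundy {n : ℕ} (moveRel : Position n → Position n → Prop)
    (P : Position n) : ℕ :=
  grundyAux moveRel (info P) P

theorem mem_nonExcluded {n : ℕ} {P : Position n} {i : Fin n} :
    i ∈ nonExcluded P ↔ P.status i ≠ CoinStatus.excluded := by
  simp [nonExcluded]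

/-- Without unknown coins, a weighing keeps the status of a coin or excludes it. -/
theorem updateStatus_eq_excluded_or_eq {n : ℕ} {P : Position n}
    (hnu : ∀ i, P.status i ≠ CoinStatus.unknown) (A B : Finset (Fin n)) (i : Fin n) :
    updateStatus P A B i = CoinStatus.excluded ∨ updateStatus P A B i = P.status i := by
  have hi := hnu i
  unfold updateStatus
  cases hs : P.status i <;> split <;> split_ifs <;> simp_all [onLighterPan, onHeavierPan]

/-- A weighing never changes the status of a counterfeit coin that follows its destiny. -/
theorem updateStatus_counterfeit {n : ℕ} {P : Position n}
    (hcf : P.status P.counterfeit = P.fakeType.destiny) {A B : Finset (Fin n)}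
    (hAB : Disjoint A B) :
    updateStatus P A B P.counterfeit = P.status P.counterfeit := by
  have hd : P.counterfeit ∈ A → P.counterfeit ∉ B := fun h => Finset.disjoint_left.mp hAB h
  unfold updateStatus outcome
  rw [hcf]
  by_cases hA : P.counterfeit ∈ A <;> by_cases hB : P.counterfeit ∈ B <;>
    cases hf : P.fakeType <;>
    simp_all [onLighterPan, onHeavierPan, FakeType.destiny]

theorem counterfeit_mem_nonExcluded {n : ℕ} {P : Position n}
    (hcf : P.status P.counterfeit = P.fakeType.destiny) : P.counterfeit ∈ nonExcluded P := by
  rw [mem_nonExcluded, hcf]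
  cases P.fakeType <;> simp [FakeType.destiny]

/-- With the counterfeit coin on the left pan, the coins that stay suspect are those sharing its
destiny on the left pan and those of the opposite destiny on the right pan. -/
theorem mem_nonExcluded_weigh {n : ℕ} {P : Position n}
    (hnu : ∀ i, P.status i ≠ CoinStatus.unknown)
    (hcf : P.status P.counterfeit = P.fakeType.destiny) {A B : Finset (Fin n)}
    (hAB : Disjoint A B) (hA : P.counterfeit ∈ A) (i : Fin n) :
    i ∈ nonExcluded (weigh P A B) ↔ P.status i ≠ CoinStatus.excluded ∧
      (i ∈ A ∧ P.status i = P.status P.counterfeit ∨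
        i ∈ B ∧ P.status i ≠ P.status P.counterfeit) := by
  have hd : i ∈ A → i ∉ B := fun h => Finset.disjoint_left.mp hAB h
  have hi := hnu i
  rw [mem_nonExcluded, hcf]
  simp only [weigh, updateStatus, outcome, if_pos hA]
  cases P.fakeType <;> cases hs : P.status i <;> by_cases hiA : i ∈ A <;>
    by_cases hiB : i ∈ B <;>
    simp_all [onLighterPan, onHeavierPan, FakeType.destiny]

/-- With two suspects left, every legal weighing reveals the counterfeit coin. -/
theorem found_of_move_of_card_eq_two {n : ℕ} {P Q : Position n}
    (hnu : ∀ i, P.status i ≠ CoinStatus.unknown)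
    (hcf : P.status P.counterfeit = P.fakeType.destiny)
    (hcard : (nonExcluded P).card = 2) (hmove : Move P Q) : Found Q := by
  obtain ⟨A, B, hAB, -, hne, rfl⟩ := hmove
  have hkeep := updateStatus_eq_excluded_or_eq hnu A B
  obtain ⟨i, hi⟩ := Function.ne_iff.mp hne
  have hss : nonExcluded (weigh P A B) ⊂ nonExcluded P := by
    refine Finset.ssubset_iff_of_subset (fun j hj => ?_) |>.mpr ⟨i, ?_, ?_⟩
    · rw [mem_nonExcluded] at hj ⊢
      exact ((hkeep j).resolve_left hj) ▸ hj
    · rw [mem_nonExcluded]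
      rintro h
      exact hi (((hkeep i).resolve_right hi).trans h.symm)
    · rw [mem_nonExcluded, not_not]
      exact (hkeep i).resolve_right hi
  have hlt := Finset.card_lt_card hss
  have hcf' : (weigh P A B).counterfeit ∈ nonExcluded (weigh P A B) :=
    counterfeit_mem_nonExcluded ((updateStatus_counterfeit hcf hAB).trans hcf)
  have hpos := Finset.card_pos.mpr ⟨_, hcf'⟩
  unfold Found
  omega

theorem misereWinAux_of_goal {n : ℕ} {moveRel : Position n → Position n → Prop}
    {goal : Position n → Prop} {P : Position n} (h : goal P) (k : ℕ) :
    MisereWinAux moveRel goal k P := by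
  cases k with
  | zero => exact h
  | succ k => exact Or.inl h

theorem not_misereWinAux_of_card_eq_two {n : ℕ} {P : Position n}
    (hnu : ∀ i, P.status i ≠ CoinStatus.unknown)
    (hcf : P.status P.counterfeit = P.fakeType.destiny)
    (hcard : (nonExcluded P).card = 2) (k : ℕ) :
    ¬ MisereWinAux (GMove Found) Found k P := by
  have hnf : ¬ Found P := by simp [Found, hcard]
  cases k with
  | zero => exact hnf
  | succ k =>
    rintro (h | ⟨Q, ⟨-, hmove⟩, hQ⟩)
    · exact hnf h
    · exact hQ (misereWinAux_of_goal (found_of_move_of_card_eq_two hnu hcf hcard hmove) k)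

/-- With at least three suspects and a coin known to be genuine, some weighing leaves exactly two
suspects. -/
theorem exists_weigh_card_eq_two {n : ℕ} {P : Position n}
    (hnu : ∀ i, P.status i ≠ CoinStatus.unknown)
    (hcf : P.status P.counterfeit = P.fakeType.destiny)
    {g : Fin n} (hg : P.status g = CoinStatus.excluded)
    (hcard : 2 < (nonExcluded P).card) :
    ∃ A B : Finset (Fin n), Disjoint A B ∧ A.card = B.card ∧
      (nonExcluded (weigh P A B)).card = 2 := by
  have hc := counterfeit_mem_nonExcluded hcf
  have hc' := mem_nonExcluded.mp hc
  by_cases hopp : ∃ d ∈ nonExcluded P, P.status d ≠ P.status P.counterfeit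
  · obtain ⟨d, hd, hdc⟩ := hopp
    have hne : P.counterfeit ≠ d := by rintro h; exact hdc (h ▸ rfl)
    have hAB : Disjoint {P.counterfeit} ({d} : Finset (Fin n)) := by simpa using hne
    refine ⟨{P.counterfeit}, {d}, hAB, by simp, ?_⟩
    rw [← Finset.card_pair hne]
    congr 1
    ext i
    rw [mem_nonExcluded_weigh hnu hcf hAB (by simp)]
    rw [mem_nonExcluded] at hd
    simp only [Finset.mem_singleton, Finset.mem_insert]
    constructor
    · tauto
    · rintro (rfl | rfl) <;> tauto
  · push Not at hopp
    obtain ⟨d, hd, e, he, hde⟩ := Finset.one_lt_card.mp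
      (show 1 < ((nonExcluded P).erase P.counterfeit).card by
        rw [Finset.card_erase_of_mem hc]; omega)
    rw [Finset.mem_erase] at hd he
    have hds := mem_nonExcluded.mp hd.2
    have hes := mem_nonExcluded.mp he.2
    have hgc : P.counterfeit ≠ g := by rintro h; exact hc' (h ▸ hg)
    have hgd : d ≠ g := by rintro rfl; exact hds hg
    have hge : e ≠ g := by rintro rfl; exact hes hg
    have hAB : Disjoint {P.counterfeit, d} ({e, g} : Finset (Fin n)) := by
      simp [hgc.symm, hgd.symm, hde.symm, he.1]
    refine ⟨{P.counterfeit, d}, {e, g}, hAB, ?_, ?_⟩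
    · rw [Finset.card_pair hd.1.symm, Finset.card_pair hge]
    · rw [← Finset.card_pair hd.1.symm]
      congr 1
      ext i
      rw [mem_nonExcluded_weigh hnu hcf hAB (by simp)]
      constructor
      · rintro ⟨hi, h | h⟩
        · exact h.1
        · exact absurd (hopp i (mem_nonExcluded.mpr hi)) h.2
      · intro h
        have hi : i ∈ nonExcluded P := by
          rcases Finset.mem_insert.mp h with rfl | h
          · exact hc
          · exact Finset.mem_singleton.mp h ▸ hd.2
        exact ⟨mem_nonExcluded.mp hi, Or.inl ⟨h, hopp i hi⟩⟩

theorem misereWin_of_two_lt_card {n : ℕ} {P : Position n}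
    (hnu : ∀ i, P.status i ≠ CoinStatus.unknown)
    (hcf : P.status P.counterfeit = P.fakeType.destiny)
    {g : Fin n} (hg : P.status g = CoinStatus.excluded)
    (hcard : 2 < (nonExcluded P).card) :
    MisereWin (GMove Found) Found P := by
  obtain ⟨A, B, hAB, hAB', h2⟩ := exists_weigh_card_eq_two hnu hcf hg hcard
  have hinfo : info P ≠ 0 := by
    intro h
    have h0 := (Finset.sum_eq_zero_iff.mp h) P.counterfeit (Finset.mem_univ _)
    rw [hcf] at h0
    cases hf : P.fakeType <;> simp [hf, FakeType.destiny, statusWeight] at h0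
  obtain ⟨k, hk⟩ := Nat.exists_eq_succ_of_ne_zero hinfo
  unfold MisereWin
  rw [hk]
  refine Or.inr ⟨weigh P A B, ⟨?_, A, B, hAB, hAB', ?_, rfl⟩, ?_⟩
  · unfold Found
    omega
  · intro h
    have : nonExcluded (weigh P A B) = nonExcluded P := by
      simp only [nonExcluded, weigh, h]
    rw [this] at h2
    omega
  · refine not_misereWinAux_of_card_eq_two (fun i hi => ?_)
      ((updateStatus_counterfeit hcf hAB).trans hcf) h2 k
    rcases updateStatus_eq_excluded_or_eq hnu A B i with h | h
    · exact CoinStatus.noConfusion (h.symm.trans hi)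
    · exact hnu i (h.symm.trans hi)

theorem card_nonExcluded_of_ne_unknown {n : ℕ} {P : Position n}
    (hnu : ∀ i, P.status i ≠ CoinStatus.unknown) :
    (nonExcluded P).card = destinedCount P := by
  rw [destinedCount, ← Finset.card_union_of_disjoint]
  · congr 1
    ext i
    have hi := hnu i
    cases hs : P.status i <;> simp_all [nonExcluded, statusSet]
  · rw [Finset.disjoint_left]
    intro i hi hi'
    simp_all [statusSet]

/-- For all `l, h ≥ 0` with `N = l + h ≥ 2`, the misère-play
destined-coins game with one extra genuine coin `DM⁺_{l,h}` is a P-position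
(a loss for the player to move under optimal play) if and only if `N = 2`. -/
theorem misereP_destined_extra {n l h : ℕ} (P : Position n)
    (hN : 2 ≤ l + h)
    (hl : (statusSet P CoinStatus.light).card = l)
    (hh : (statusSet P CoinStatus.heavy).card = h)
    (he : (statusSet P CoinStatus.excluded).card = 1)
    (hnu : statusSet P CoinStatus.unknown = ∅)
    (hcf : P.status P.counterfeit = P.fakeType.destiny) :
    ¬ MisereWin (GMove Found) Found P ↔ l + h = 2 := by
  have hnu' : ∀ i, P.status i ≠ CoinStatus.unknown := fun i hi => by
    have hmem : i ∈ statusSet P CoinStatus.unknown := by simp [statusSet, hi]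
    simp [hnu] at hmem
  have hcard : (nonExcluded P).card = l + h := by
    rw [card_nonExcluded_of_ne_unknown hnu', destinedCount, hl, hh]
  obtain ⟨g, hg⟩ := Finset.card_pos.mp (he.symm ▸ Nat.one_pos)
  have hg' : P.status g = CoinStatus.excluded := by simpa [statusSet] using hg
  constructor
  · intro hP
    by_contra hne
    exact hP (misereWin_of_two_lt_card hnu' hcf hg' (by omega))
  · intro h2
    exact not_misereWinAux_of_card_eq_two hnu' hcf (hcard.trans h2) _
end

section
/- For l, h ≥ 0 with N = l + h ≥ 2 and (l,h) ≠ (1,1), the Grundy value of the normal-play destined-coins game satisfies G(D_{l,h}) = m* − 1, where m* is the smallest positive integer that is not a possible value of the number of non-excluded coins after one legal weighing from the starting position (explicitly: m* = 1 if N is even, l ≠ h and the counterfeit is the unique coin of its destiny; m* = N − 1 if l = h; and otherwise m* = min(N, s) with s the least integer exceeding ⌊N/2⌋ + min(l,h) whose parity differs from that of N). -/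
/-- A position in which every candidate coin is destined and the counterfeit carries its true
destiny. -/
structure IsDestined {n : ℕ} (P : Position n) : Prop where
  ne_unknown : ∀ i, P.status i ≠ CoinStatus.unknown
  status_counterfeit : P.status P.counterfeit = P.fakeType.destiny

/-- The non-excluded coins whose status differs from that of the counterfeit coin. -/
def oppositeSet {n : ℕ} (P : Position n) : Finset (Fin n) :=
  nonExcluded P \ statusSet P (P.status P.counterfeit)

/-- The coins that stay non-excluded after weighing `A` against `B` in a destined position. -/
def remaining {n : ℕ} (P : Position n) (A B : Finset (Fin n)) : Finset (Fin n) :=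
  if P.counterfeit ∈ A then A ∩ statusSet P (P.status P.counterfeit) ∪ B ∩ oppositeSet P
  else if P.counterfeit ∈ B then B ∩ statusSet P (P.status P.counterfeit) ∪ A ∩ oppositeSet P
  else nonExcluded P \ (A ∪ B)

section Destined

variable {n : ℕ} {P Q : Position n} {A B : Finset (Fin n)}

theorem IsDestined.counterfeit_mem (hP : IsDestined P) : P.counterfeit ∈ nonExcluded P := by
  have := hP.status_counterfeit
  cases h : P.fakeType <;> simp_all [nonExcluded, FakeType.destiny]

theorem IsDestined.statusSet_subset (hP : IsDestined P) :
    statusSet P (P.status P.counterfeit) ⊆ nonExcluded P := by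
  have := hP.counterfeit_mem
  intro i
  simp_all [nonExcluded, statusSet]

theorem IsDestined.card_statusSet_add (hP : IsDestined P) :
    (statusSet P (P.status P.counterfeit)).card + (oppositeSet P).card =
      (nonExcluded P).card := by
  rw [oppositeSet, add_comm, Finset.card_sdiff_add_card_eq_card hP.statusSet_subset]

theorem counterfeit_mem_statusSet : P.counterfeit ∈ statusSet P (P.status P.counterfeit) := by
  simp [statusSet]

theorem disjoint_statusSet_oppositeSet :
    Disjoint (statusSet P (P.status P.counterfeit)) (oppositeSet P) :=
  Finset.disjoint_sdiff

theorem IsDestined.remaining_subset (hP : IsDestined P) :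
    remaining P A B ⊆ nonExcluded P := by
  have := hP.statusSet_subset
  intro i
  unfold remaining oppositeSet
  split_ifs <;> grind

theorem IsDestined.counterfeit_mem_remaining (hP : IsDestined P) :
    P.counterfeit ∈ remaining P A B := by
  have := hP.counterfeit_mem
  have := counterfeit_mem_statusSet (P := P)
  unfold remaining
  split_ifs <;> grind

theorem IsDestined.updateStatus_eq (hP : IsDestined P) (hAB : Disjoint A B) (i : Fin n) :
    updateStatus P A B i =
      if i ∈ remaining P A B then P.status i else CoinStatus.excluded := by
  have hu := hP.ne_unknown i
  have hc := hP.status_counterfeit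
  have hd : i ∈ A → i ∉ B := fun h => Finset.disjoint_left.1 hAB h
  by_cases hcA : P.counterfeit ∈ A <;> by_cases hcB : P.counterfeit ∈ B <;>
  by_cases hA : i ∈ A <;> by_cases hB : i ∈ B <;>
  cases hf : P.fakeType <;> cases hs : P.status i <;>
  simp_all [updateStatus, outcome, remaining, oppositeSet, nonExcluded, statusSet,
    onLighterPan, onHeavierPan, FakeType.destiny]

theorem IsDestined.nonExcluded_weigh (hP : IsDestined P) (hAB : Disjoint A B) :
    nonExcluded (weigh P A B) = remaining P A B := by
  ext i
  have := @IsDestined.remaining_subset n P A B hP i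
  simp only [nonExcluded, weigh, hP.updateStatus_eq hAB, Finset.mem_filter, Finset.mem_univ,
    true_and] at *
  split_ifs <;> simp_all

theorem IsDestined.weigh (hP : IsDestined P) (hAB : Disjoint A B) :
    IsDestined (weigh P A B) where
  ne_unknown i := by
    have := hP.ne_unknown i
    simp only [_root_.weigh, hP.updateStatus_eq hAB]
    split_ifs <;> simp_all
  status_counterfeit := by
    simp [_root_.weigh, hP.updateStatus_eq hAB, hP.counterfeit_mem_remaining,
      hP.status_counterfeit]

/-- In a destined position a weighing is legal iff it excludes a new coin. -/
theorem IsDestined.updateStatus_ne_iff (hP : IsDestined P) (hAB : Disjoint A B) :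
    updateStatus P A B ≠ P.status ↔ (remaining P A B).card < (nonExcluded P).card := by
  constructor
  · intro h
    refine Finset.card_lt_card (hP.remaining_subset.ssubset_of_ne fun he => h ?_)
    ext i
    rw [hP.updateStatus_eq hAB, he]
    simp only [nonExcluded, Finset.mem_filter, Finset.mem_univ, true_and]
    split_ifs <;> simp_all
  · intro h he
    have h' := hP.nonExcluded_weigh hAB
    rw [← h', nonExcluded, nonExcluded, _root_.weigh, he] at h
    exact lt_irrefl _ h

theorem IsDestined.move_iff (hP : IsDestined P) :
    Move P Q ↔ ∃ A B, Disjoint A B ∧ A.card = B.card ∧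
      (remaining P A B).card < (nonExcluded P).card ∧ Q = _root_.weigh P A B := by
  unfold Move
  refine exists₂_congr fun A B => and_congr_right fun hAB => ?_
  rw [hP.updateStatus_ne_iff hAB]

theorem IsDestined.of_move (hP : IsDestined P) (h : Move P Q) : IsDestined Q := by
  obtain ⟨A, B, hAB, -, -, rfl⟩ := h
  exact hP.weigh hAB

theorem IsDestined.card_lt_of_move (hP : IsDestined P) (h : Move P Q) :
    (nonExcluded Q).card < (nonExcluded P).card := by
  obtain ⟨A, B, hAB, -, hlt, rfl⟩ := hP.move_iff.1 h
  rwa [hP.nonExcluded_weigh hAB]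

theorem IsDestined.card_pos (hP : IsDestined P) : 0 < (nonExcluded P).card :=
  Finset.card_pos.2 ⟨_, hP.counterfeit_mem⟩

theorem IsDestined.info_eq (hP : IsDestined P) : info P = (nonExcluded P).card := by
  rw [info, nonExcluded, Finset.card_filter]
  refine Finset.sum_congr rfl fun i _ => ?_
  have := hP.ne_unknown i
  cases h : P.status i <;> simp_all [statusWeight]

theorem IsDestined.exists_move_of_disjoint (hP : IsDestined P) (hAB : Disjoint A B)
    (hcard : A.card = B.card) (hA : P.counterfeit ∉ A) (hB : P.counterfeit ∉ B)
    {k : ℕ} (hk : 0 < k) (hi : (nonExcluded P ∩ (A ∪ B)).card = k) :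
    ∃ Q, Move P Q ∧ (nonExcluded Q).card = (nonExcluded P).card - k := by
  have hr : (remaining P A B).card = (nonExcluded P).card - k := by
    rw [remaining, if_neg hA, if_neg hB, Finset.card_sdiff, Finset.inter_comm, hi]
  refine ⟨_, hP.move_iff.2 ⟨A, B, hAB, hcard, ?_, rfl⟩, ?_⟩
  · have := hP.card_pos
    omega
  · rw [hP.nonExcluded_weigh hAB, hr]

/-- Balanced weighings realise every number of exclusions of even size. -/
theorem IsDestined.exists_move_even (hP : IsDestined P) {j : ℕ} (hj : 0 < j)
    (hlt : 2 * j < (nonExcluded P).card) :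
    ∃ Q, Move P Q ∧ (nonExcluded Q).card = (nonExcluded P).card - 2 * j := by
  have he := Finset.card_erase_of_mem hP.counterfeit_mem
  obtain ⟨A, hA, hAc⟩ := Finset.exists_subset_card_eq
    (s := (nonExcluded P).erase P.counterfeit) (n := j) (by omega)
  have hs := Finset.card_sdiff_of_subset hA
  obtain ⟨B, hB, hBc⟩ := Finset.exists_subset_card_eq
    (s := (nonExcluded P).erase P.counterfeit \ A) (n := j) (by omega)
  have hAB : Disjoint A B := Finset.disjoint_left.2 (by grind)
  refine hP.exists_move_of_disjoint hAB (by omega) (by grind) (by grind) (by omega) ?_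
  rw [Finset.inter_eq_right.2 (by grind), Finset.card_union_of_disjoint hAB]
  omega

/-- An excluded coin can be used to balance an odd number of exclusions. -/
theorem IsDestined.exists_move_odd (hP : IsDestined P) {x : Fin n} (hx : x ∉ nonExcluded P)
    {j : ℕ} (hlt : 2 * j + 1 < (nonExcluded P).card) :
    ∃ Q, Move P Q ∧ (nonExcluded Q).card = (nonExcluded P).card - (2 * j + 1) := by
  have he := Finset.card_erase_of_mem hP.counterfeit_mem
  have hc := hP.counterfeit_mem
  obtain ⟨A, hA, hAc⟩ := Finset.exists_subset_card_eq
    (s := (nonExcluded P).erase P.counterfeit) (n := j + 1) (by omega)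
  have hs := Finset.card_sdiff_of_subset hA
  obtain ⟨B, hB, hBc⟩ := Finset.exists_subset_card_eq
    (s := (nonExcluded P).erase P.counterfeit \ A) (n := j) (by omega)
  have hAB : Disjoint A B := Finset.disjoint_left.2 (by grind)
  have hxB : x ∉ B := by grind
  have hAxB : Disjoint A (insert x B) := Finset.disjoint_left.2 (by grind)
  refine hP.exists_move_of_disjoint (A := A) (B := insert x B) hAxB ?_ (by grind) (by grind)
    (by omega) ?_
  · rw [Finset.card_insert_of_notMem hxB]
    omega
  · have : nonExcluded P ∩ (A ∪ insert x B) = A ∪ B := by grind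
    rw [this, Finset.card_union_of_disjoint hAB]
    omega

theorem IsDestined.exists_move_of_excluded (hP : IsDestined P) {x : Fin n}
    (hx : x ∉ nonExcluded P) {m : ℕ} (hm : 0 < m) (hlt : m < (nonExcluded P).card) :
    ∃ Q, Move P Q ∧ (nonExcluded Q).card = m := by
  obtain ⟨j, hj | hj⟩ := Nat.even_or_odd' ((nonExcluded P).card - m)
  · obtain ⟨Q, hQ, h⟩ := hP.exists_move_even (j := j) (by omega) (by omega)
    exact ⟨Q, hQ, by omega⟩
  · obtain ⟨Q, hQ, h⟩ := hP.exists_move_odd hx (j := j) (by omega)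
    exact ⟨Q, hQ, by omega⟩

theorem mex_eq_of_isLeast {s : Set ℕ} {k : ℕ} (h : IsLeast {k | k ∉ s} k) : mex s = k :=
  h.csInf_eq

/-- Once some coin is excluded, the Grundy value is one less than the number of candidates. -/
theorem grundyAux_of_excluded (k : ℕ) :
    ∀ P : Position n, IsDestined P → (∃ x, x ∉ nonExcluded P) → (nonExcluded P).card ≤ k →
      grundyAux (GMove Found) k P = (nonExcluded P).card - 1 := by
  induction k with
  | zero =>
    intro P hP _ hk
    have := hP.card_pos
    omega
  | succ k ih =>
    rintro P hP ⟨x, hx⟩ hk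
    have hval : ∀ Q, Move P Q →
        grundyAux (GMove Found) k Q = (nonExcluded Q).card - 1 := by
      intro Q hQ
      have hlt := hP.card_lt_of_move hQ
      refine ih Q (hP.of_move hQ) ⟨x, ?_⟩ (by omega)
      obtain ⟨A, B, hAB, -, -, rfl⟩ := hQ
      rw [hP.nonExcluded_weigh hAB]
      exact fun h => hx (hP.remaining_subset h)
    refine mex_eq_of_isLeast ⟨?_, ?_⟩
    · rintro ⟨Q, ⟨-, hQ⟩, hg⟩
      rw [hval Q hQ] at hg
      have := hP.card_lt_of_move hQ
      have := (hP.of_move hQ).card_pos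
      omega
    · intro g hg
      by_contra! hlt
      refine hg ?_
      obtain ⟨Q, hQ, hc⟩ := hP.exists_move_of_excluded hx (m := g + 1) (by omega) (by omega)
      refine ⟨Q, ⟨?_, hQ⟩, ?_⟩
      · unfold Found
        omega
      · rw [hval Q hQ]
        omega

theorem IsDestined.grundy_eq_pred (hP : IsDestined P) (hN : 2 ≤ (nonExcluded P).card) {m : ℕ}
    (hm : IsLeast {m : ℕ | 0 < m ∧ ¬ ∃ Q, Move P Q ∧ (nonExcluded Q).card = m} m) :
    grundy (GMove Found) P = m - 1 := by
  obtain ⟨k, hk⟩ : ∃ k, info P = k + 1 := ⟨info P - 1, by rw [hP.info_eq]; omega⟩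
  have hval : ∀ Q, Move P Q →
      grundyAux (GMove Found) k Q = (nonExcluded Q).card - 1 := by
    intro Q hQ
    have hlt := hP.card_lt_of_move hQ
    rw [hP.info_eq] at hk
    refine grundyAux_of_excluded k Q (hP.of_move hQ) ?_ (by omega)
    by_contra! hall
    have := Finset.card_le_card
      (show nonExcluded P ⊆ nonExcluded Q from fun i _ => hall i)
    omega
  obtain ⟨⟨hpos, hnot⟩, hleast⟩ := hm
  rw [grundy, hk]
  refine mex_eq_of_isLeast ⟨?_, ?_⟩
  · rintro ⟨Q, ⟨-, hQ⟩, hg⟩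
    rw [hval Q hQ] at hg
    have := (hP.of_move hQ).card_pos
    exact hnot ⟨Q, hQ, by omega⟩
  · intro g hg
    have : m ≤ g + 1 := by
      refine hleast ⟨by omega, ?_⟩
      rintro ⟨Q, hQ, hc⟩
      refine hg ⟨Q, ⟨?_, hQ⟩, ?_⟩
      · unfold Found
        omega
      · rw [hval Q hQ]
        omega
    omega

/-- The numbers `m` of candidates that an unbalanced weighing can leave, when the counterfeit
shares its destiny with `a` coins and `b` coins have the opposite destiny: `p` and `x` count the
coins of the two destinies on the pan of the counterfeit, `y` and `q` those on the other pan. -/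
def UnbalancedCount (a b m : ℕ) : Prop :=
  ∃ p q x y : ℕ, 1 ≤ p ∧ p + q = m ∧ p + x = y + q ∧ p + y ≤ a ∧ q + x ≤ b

theorem unbalancedCount_of_mem (hall : ∀ i, i ∈ nonExcluded P) (hAB : Disjoint A B)
    (hcard : A.card = B.card) (hA : P.counterfeit ∈ A) :
    UnbalancedCount (statusSet P (P.status P.counterfeit)).card (oppositeSet P).card
      (A ∩ statusSet P (P.status P.counterfeit) ∪ B ∩ oppositeSet P).card := by
  set S := statusSet P (P.status P.counterfeit) with hS
  have hST : Disjoint S (oppositeSet P) := disjoint_statusSet_oppositeSet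
  have hc : P.counterfeit ∈ S := counterfeit_mem_statusSet
  have hsplit : ∀ X : Finset (Fin n), (X ∩ S).card + (X ∩ oppositeSet P).card = X.card := by
    intro X
    rw [← Finset.card_inter_add_card_sdiff X S]
    congr 2
    ext i
    have := hall i
    simp only [oppositeSet, ← hS]
    grind
  have hdisj : ∀ T : Finset (Fin n), (A ∩ T).card + (B ∩ T).card ≤ T.card := by
    intro T
    rw [← Finset.card_union_of_disjoint
      (Finset.disjoint_of_subset_left Finset.inter_subset_left
        (Finset.disjoint_of_subset_right Finset.inter_subset_left hAB))]
    exact Finset.card_le_card (by grind)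
  have h1 := hsplit A
  have h2 := hsplit B
  refine ⟨(A ∩ S).card, (B ∩ oppositeSet P).card, (A ∩ oppositeSet P).card, (B ∩ S).card,
    Finset.card_pos.2 ⟨_, Finset.mem_inter.2 ⟨hA, hc⟩⟩, ?_, by omega, hdisj S, ?_⟩
  · rw [Finset.card_union_of_disjoint]
    exact Finset.disjoint_of_subset_left Finset.inter_subset_left
        (Finset.disjoint_of_subset_right Finset.inter_subset_left hAB)
  · have := hdisj (oppositeSet P)
    omega

theorem IsDestined.exists_move_of_unbalancedCount (hP : IsDestined P) {m : ℕ}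
    (hm : UnbalancedCount (statusSet P (P.status P.counterfeit)).card (oppositeSet P).card m)
    (hlt : m < (nonExcluded P).card) : ∃ Q, Move P Q ∧ (nonExcluded Q).card = m := by
  obtain ⟨p, q, x, y, hp, rfl, hbal, hS, hT⟩ := hm
  have hc := counterfeit_mem_statusSet (P := P)
  have hST := disjoint_statusSet_oppositeSet (P := P)
  set S := statusSet P (P.status P.counterfeit) with hSdef
  set T := oppositeSet P with hTdef
  have hST' : ∀ ⦃i⦄, i ∈ S → i ∉ T := Finset.disjoint_left.1 hST
  obtain ⟨X, hcX, hXS, hX⟩ := Finset.exists_subsuperset_card_eq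
    (Finset.singleton_subset_iff.2 hc) (n := p) (by simpa using hp) (by omega)
  have h1 := Finset.card_sdiff_of_subset hXS
  obtain ⟨Y, hYS, hY⟩ := Finset.exists_subset_card_eq (s := S \ X) (n := y) (by omega)
  obtain ⟨Z, hZT, hZ⟩ := Finset.exists_subset_card_eq (s := T) (n := q) (by omega)
  have h2 := Finset.card_sdiff_of_subset hZT
  obtain ⟨W, hWT, hW⟩ := Finset.exists_subset_card_eq (s := T \ Z) (n := x) (by omega)
  have hXW : Disjoint X W := Finset.disjoint_left.2 (by grind)
  have hYZ : Disjoint Y Z := Finset.disjoint_left.2 (by grind)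
  have hXZ : Disjoint X Z := Finset.disjoint_left.2 (by grind)
  have hAB : Disjoint (X ∪ W) (Y ∪ Z) := Finset.disjoint_left.2 (by grind)
  have hr : (remaining P (X ∪ W) (Y ∪ Z)).card = p + q := by
    rw [remaining, if_pos (by grind), ← hSdef, ← hTdef, ← hX, ← hZ,
      ← Finset.card_union_of_disjoint hXZ]
    congr 1
    ext i
    have := @hST' i
    grind
  refine ⟨_, hP.move_iff.2 ⟨X ∪ W, Y ∪ Z, hAB, ?_, by omega, rfl⟩, ?_⟩
  · rw [Finset.card_union_of_disjoint hXW, Finset.card_union_of_disjoint hYZ]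
    omega
  · rw [hP.nonExcluded_weigh hAB, hr]

/-- The candidate counts reachable in one legal weighing when no coin is excluded yet. -/
theorem IsDestined.exists_move_iff (hP : IsDestined P) (hall : ∀ i, i ∈ nonExcluded P) {m : ℕ} :
    (∃ Q, Move P Q ∧ (nonExcluded Q).card = m) ↔
      0 < m ∧ m < (nonExcluded P).card ∧ (m % 2 = (nonExcluded P).card % 2 ∨
        UnbalancedCount (statusSet P (P.status P.counterfeit)).card (oppositeSet P).card m) := by
  constructor
  · rintro ⟨Q, hQ, rfl⟩
    refine ⟨(hP.of_move hQ).card_pos, hP.card_lt_of_move hQ, ?_⟩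
    obtain ⟨A, B, hAB, hcard, -, rfl⟩ := hQ
    rw [hP.nonExcluded_weigh hAB, remaining]
    split_ifs with hA hB
    · exact .inr (unbalancedCount_of_mem hall hAB hcard hA)
    · exact .inr (unbalancedCount_of_mem hall hAB.symm hcard.symm hB)
    · left
      have hsub : A ∪ B ⊆ nonExcluded P := fun i _ => hall i
      have h1 := Finset.card_sdiff_add_card_eq_card hsub
      rw [Finset.card_union_of_disjoint hAB] at h1
      omega
  · rintro ⟨hpos, hlt, hpar | hm⟩
    · obtain ⟨Q, hQ, h⟩ := hP.exists_move_even
        (j := ((nonExcluded P).card - m) / 2) (by omega) (by omega)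
      exact ⟨Q, hQ, by omega⟩
    · exact hP.exists_move_of_unbalancedCount hm hlt

end Destined

theorem unbalancedCount_iff {a b m : ℕ} (hab : a ≠ b) (ha : 1 ≤ a) (hm : 0 < m) :
    UnbalancedCount a b m ↔ m ≤ (a + b) / 2 + min a b ∧ (m = 1 → 2 ≤ a) := by
  constructor
  · rintro ⟨p, q, x, y, h⟩
    omega
  · rintro ⟨h1, h2⟩
    by_cases hlow : m ≤ 2 * min a b
    · obtain ⟨r, hr | hr⟩ := Nat.even_or_odd' m
      · exact ⟨r, r, 0, 0, by omega⟩
      · by_cases hr2 : r + 2 ≤ a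
        · exact ⟨r + 1, r, 0, 1, by omega⟩
        · exact ⟨r, r + 1, 1, 0, by omega⟩
    · by_cases hlt : a < b
      · exact ⟨a, m - a, m - 2 * a, 0, by omega⟩
      · exact ⟨m - b, b, 0, m - 2 * b, by omega⟩

theorem unbalancedCount_self_iff {a m : ℕ} (hm : m % 2 = 1) :
    UnbalancedCount a a m ↔ m + 3 ≤ 2 * a := by
  constructor
  · rintro ⟨p, q, x, y, h⟩
    omega
  · intro h
    exact ⟨m / 2 + 1, m / 2, 0, 1, by omega⟩

/-- The least positive number of candidates not reachable in one legal weighing. -/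
theorem eq_of_isLeast_unreachable {a b m : ℕ} (ha : 1 ≤ a) (hab : 2 ≤ a + b)
    (h11 : ¬ (a = 1 ∧ b = 1))
    (hm : IsLeast {m : ℕ | 0 < m ∧ ¬ (0 < m ∧ m < a + b ∧
      (m % 2 = (a + b) % 2 ∨ UnbalancedCount a b m))} m) :
    m =
      (if Even (a + b) ∧ a ≠ b ∧ a = 1 then 1
       else if a = b then a + b - 1
       else
        min (a + b)
          (if ((a + b) / 2 + min a b + 1) % 2 ≠ (a + b) % 2
           then (a + b) / 2 + min a b + 1
           else (a + b) / 2 + min a b + 2)) := by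
  refine hm.unique ?_
  simp only [Nat.even_iff]
  by_cases hne : a = b
  · subst hne
    rw [if_neg (by omega), if_pos rfl]
    constructor
    · refine ⟨by omega, ?_⟩
      rintro ⟨-, -, h | h⟩
      · omega
      · rw [unbalancedCount_self_iff (by omega)] at h
        omega
    · rintro k ⟨hk, hk'⟩
      by_contra! hlt
      refine hk' ⟨hk, by omega, ?_⟩
      by_cases hpar : k % 2 = 1
      · rw [unbalancedCount_self_iff hpar]
        omega
      · omega
  · constructor
    · refine ⟨by split_ifs <;> omega, ?_⟩
      rintro ⟨hpos, h1, h2⟩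
      rw [unbalancedCount_iff hne ha hpos] at h2
      split_ifs at * <;> omega
    · rintro k ⟨hk, hk'⟩
      rw [unbalancedCount_iff hne ha hk] at hk'
      split_ifs at * <;> omega

/-- For `l, h ≥ 0` with `N = l + h ≥ 2` and `(l,h) ≠ (1,1)`,
the Grundy value of the normal-play destined-coins game is `G(D_{l,h}) = m* - 1`,
where `m*` is the smallest positive integer that is not a possible value of the
number of non-excluded coins after one legal weighing from the starting
position; explicitly, `m* = 1` if `N` is even, `l ≠ h` and the counterfeit coin
is the unique coin of its destiny; `m* = N - 1` if `l = h`; and otherwise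
`m* = min N s` with `s` the least integer exceeding `⌊N/2⌋ + min l h` whose
parity differs from that of `N`. -/
theorem grundy_destined_normal {n l h : ℕ} (P : Position n)
    (hN : 2 ≤ l + h) (hlh : ¬ (l = 1 ∧ h = 1))
    (hl : (statusSet P CoinStatus.light).card = l)
    (hh : (statusSet P CoinStatus.heavy).card = h)
    (hd : ∀ i, P.status i = CoinStatus.light ∨ P.status i = CoinStatus.heavy)
    (hcf : P.status P.counterfeit = P.fakeType.destiny)
    (mstar : ℕ)
    (hm : IsLeast {m : ℕ | 0 < m ∧ ¬ ∃ Q, Move P Q ∧ (nonExcluded Q).card = m}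
            mstar) :
    grundy (GMove Found) P = mstar - 1 ∧
    mstar =
      (if Even (l + h) ∧ l ≠ h ∧ sameDestinyCount P = 1 then 1
       else if l = h then l + h - 1
       else
        min (l + h)
          (if ((l + h) / 2 + min l h + 1) % 2 ≠ (l + h) % 2
           then (l + h) / 2 + min l h + 1
           else (l + h) / 2 + min l h + 2)) := by
  have hP : IsDestined P := ⟨fun i => by rcases hd i with h | h <;> simp [h], hcf⟩
  have hall : ∀ i, i ∈ nonExcluded P := fun i => by
    rcases hd i with h | h <;> simp [nonExcluded, h]
  have hcard : (nonExcluded P).card = l + h := by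
    rw [← hl, ← hh, ← Finset.card_union_of_disjoint]
    · congr 1
      ext i
      rcases hd i with h | h <;> simp [nonExcluded, statusSet, h]
    · exact Finset.disjoint_left.2 (by simp +contextual [statusSet])
  refine ⟨hP.grundy_eq_pred (by omega) hm, ?_⟩
  have hadd := hP.card_statusSet_add
  have hsame : sameDestinyCount P = (statusSet P (P.status P.counterfeit)).card := rfl
  have hpos : 0 < (statusSet P (P.status P.counterfeit)).card :=
    Finset.card_pos.2 ⟨_, counterfeit_mem_statusSet⟩
  simp only [hP.exists_move_iff hall, ← hadd] at hm
  rw [hsame]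
  have key := eq_of_isLeast_unreachable hpos (by omega) ?_ hm
  · rcases hd P.counterfeit with hc | hc
    · rw [hc, hl] at key hadd hpos ⊢
      obtain rfl : (oppositeSet P).card = h := by omega
      exact key
    · rw [hc, hh] at key hadd hpos ⊢
      obtain rfl : (oppositeSet P).card = l := by omega
      rw [add_comm (oppositeSet P).card, min_comm (oppositeSet P).card]
      simpa only [ne_comm, eq_comm] using key
  · rcases hd P.counterfeit with hc | hc
    · rw [hc, hl] at hadd ⊢
      omega
    · rw [hc, hh] at hadd ⊢
      omega
end

section
/- For l, h ≥ 0 with N = l + h ≥ 2 and (l,h) ≠ (1,1), the starting position of the normal-play destined-coins game D_{l,h} is a P-position if and only if N is even, min(l,h) = 1, and the counterfeit coin is the unique coin of its destiny. (The one-coin position N = 1 is also a P-position, being terminal.) -/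
lemma found_iff {n : ℕ} {P : Position n} (hc : P.status P.counterfeit ≠ CoinStatus.excluded) :
    Found P ↔ ∀ i, i ≠ P.counterfeit → P.status i = CoinStatus.excluded := by
  have hmem : P.counterfeit ∈ nonExcluded P := by simp [nonExcluded, hc]
  unfold Found
  rw [Finset.card_eq_one]
  constructor
  · rintro ⟨a, ha⟩ i hi
    by_contra hne
    have hia : i ∈ nonExcluded P := by simp [nonExcluded, hne]
    rw [ha, Finset.mem_singleton] at hmem hia
    exact hi (hia.trans hmem.symm)
  · intro hall
    refine ⟨P.counterfeit, Finset.eq_singleton_iff_unique_mem.2 ⟨hmem, fun i hi => ?_⟩⟩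
    by_contra hne
    simp [nonExcluded, hall i hne] at hi

lemma not_normalWinAux_of_found {n : ℕ} {P : Position n} (hP : Found P) (k : ℕ) :
    ¬ NormalWinAux (GMove Found) k P := by
  cases k with
  | zero => exact id
  | succ k => rintro ⟨Q, hQ, -⟩; exact hQ.1 hP

/-- A player who can reveal the counterfeit coin in one weighing wins. -/
lemma normalWinAux_of_found_weigh {n : ℕ} {P : Position n} {A B : Finset (Fin n)} {k : ℕ}
    (hk : 1 ≤ k) (hP : ¬ Found P) (hAB : Disjoint A B) (hcard : A.card = B.card)
    (hQ : Found (weigh P A B)) : NormalWinAux (GMove Found) k P := by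
  obtain ⟨k, rfl⟩ := Nat.exists_eq_add_of_le' hk
  refine ⟨weigh P A B, ⟨hP, A, B, hAB, hcard, fun heq => hP ?_, rfl⟩,
    not_normalWinAux_of_found hQ k⟩
  simpa [Found, nonExcluded, weigh, heq] using hQ

/-- If the genuine non-excluded coins lie in a set of even size avoiding the counterfeit,
then weighing this set against itself, split in halves, wins. -/
lemma normalWinAux_of_even_card {n : ℕ} {P : Position n} {S : Finset (Fin n)} {k : ℕ}
    (hk : 1 ≤ k) (hP : ¬ Found P) (hc : P.status P.counterfeit ≠ CoinStatus.excluded)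
    (hcS : P.counterfeit ∉ S) (hS : Even S.card)
    (hSall : ∀ i, i ≠ P.counterfeit → i ∉ S → P.status i = CoinStatus.excluded) :
    NormalWinAux (GMove Found) k P := by
  obtain ⟨m, hm⟩ := hS
  obtain ⟨A, hAS, hA⟩ := Finset.exists_subset_card_eq (s := S) (n := m) (by omega)
  have hout : outcome P A (S \ A) = Outcome.balanced := by
    have hcA : P.counterfeit ∉ A := fun h => hcS (hAS h)
    simp [outcome, hcA, hcS]
  have hstat : ∀ i, (weigh P A (S \ A)).status i =
      if i ∈ S then CoinStatus.excluded else P.status i := by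
    intro i
    have hiff : (i ∈ A ∨ i ∈ S \ A) ↔ i ∈ S := by
      have := @hAS i
      simp only [Finset.mem_sdiff]
      tauto
    simp only [weigh, updateStatus, hout, hiff]
  refine normalWinAux_of_found_weigh hk hP Finset.disjoint_sdiff (B := S \ A) ?_ ?_
  · rw [Finset.card_sdiff_of_subset hAS]
    omega
  · have hcQ : (weigh P A (S \ A)).status P.counterfeit = P.status P.counterfeit := by
      rw [hstat, if_neg hcS]
    refine (found_iff (P := weigh P A (S \ A)) (by rw [← hcQ] at hc; exact hc)).2
      fun i hi => ?_
    rw [hstat]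
    split_ifs with h
    · rfl
    · exact hSall i hi h

/-- Two coins of the counterfeit's destiny, one of them the counterfeit, weighed against each
other reveal it. -/
lemma normalWinAux_of_same_destiny {n : ℕ} {P : Position n} {j : Fin n} {k : ℕ}
    (hk : 1 ≤ k) (hP : ¬ Found P) (hcf : P.status P.counterfeit = P.fakeType.destiny)
    (hj : j ≠ P.counterfeit) (hjs : P.status j = P.status P.counterfeit) :
    NormalWinAux (GMove Found) k P := by
  refine normalWinAux_of_found_weigh (A := {P.counterfeit}) (B := {j}) hk hP
    (by simpa using hj.symm) (by simp) ?_
  rw [found_iff]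
  · intro i hi
    have hi : i ≠ P.counterfeit := hi
    by_cases hij : i = j <;> cases hf : P.fakeType <;>
      simp_all [weigh, updateStatus, outcome, onLighterPan, onHeavierPan, FakeType.destiny]
  · cases hf : P.fakeType <;>
      simp_all [weigh, updateStatus, outcome, onLighterPan, FakeType.destiny, onHeavierPan,
        hj.symm]

lemma weigh_status_counterfeit {n : ℕ} {P : Position n} {A B : Finset (Fin n)}
    (hAB : Disjoint A B) (hcf : P.status P.counterfeit = P.fakeType.destiny) :
    (weigh P A B).status P.counterfeit = P.fakeType.destiny := by
  have hdis : P.counterfeit ∈ A → P.counterfeit ∉ B := fun h => Finset.disjoint_left.1 hAB h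
  by_cases hA : P.counterfeit ∈ A <;> by_cases hB : P.counterfeit ∈ B <;>
    cases hf : P.fakeType <;>
    simp_all [weigh, updateStatus, outcome, onLighterPan, FakeType.destiny, onHeavierPan]

lemma updateStatus_eq_or_excluded {n : ℕ} (P : Position n) (A B : Finset (Fin n)) {i : Fin n}
    (hi : P.status i = CoinStatus.light ∨ P.status i = CoinStatus.heavy) :
    updateStatus P A B i = P.status i ∨ updateStatus P A B i = CoinStatus.excluded := by
  unfold updateStatus
  rcases hi with hi | hi <;> rw [hi] <;> split <;> split_ifs <;>
    simp [onLighterPan, onHeavierPan]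

/-- If all coins are destined, their number is even and the counterfeit is alone in its destiny,
then no weighing reveals it. -/
lemma not_found_weigh {n : ℕ} {P : Position n} {A B : Finset (Fin n)}
    (hd : ∀ i, P.status i = CoinStatus.light ∨ P.status i = CoinStatus.heavy)
    (hcf : P.status P.counterfeit = P.fakeType.destiny) (hn : Even n)
    (huniq : ∀ i, i ≠ P.counterfeit → P.status i ≠ P.status P.counterfeit)
    (hAB : Disjoint A B) (hcard : A.card = B.card) : ¬ Found (weigh P A B) := by
  have hcQ := weigh_status_counterfeit hAB hcf
  rw [found_iff (P := weigh P A B)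
    (by change (weigh P A B).status P.counterfeit ≠ _
        rw [hcQ]; cases P.fakeType <;> simp [FakeType.destiny])]
  intro hall
  have hdis : ∀ i, i ∈ A → i ∉ B := fun i h => Finset.disjoint_left.1 hAB h
  -- a coin on the pan opposite to the counterfeit keeps its status
  by_cases hA : P.counterfeit ∈ A
  · obtain ⟨b, hb⟩ : B.Nonempty := by
      rw [← Finset.card_pos, ← hcard]; exact Finset.card_pos.2 ⟨_, hA⟩
    have hbA : b ∉ A := fun h => hdis b h hb
    have hbc : b ≠ P.counterfeit := fun h => hbA (h ▸ hA)
    have h1 := hall b hbc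
    have h2 := huniq b hbc
    have h3 := hd b
    cases hf : P.fakeType <;>
      simp_all [weigh, updateStatus, outcome, onLighterPan, FakeType.destiny, onHeavierPan]
  · by_cases hB : P.counterfeit ∈ B
    · obtain ⟨b, hb⟩ : A.Nonempty := by
        rw [← Finset.card_pos, hcard]; exact Finset.card_pos.2 ⟨_, hB⟩
      have hbB : b ∉ B := hdis b hb
      have hbc : b ≠ P.counterfeit := fun h => hbB (h ▸ hB)
      have h1 := hall b hbc
      have h2 := huniq b hbc
      have h3 := hd b
      cases hf : P.fakeType <;>
        simp_all [weigh, updateStatus, outcome, onLighterPan, FakeType.destiny, onHeavierPan]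
    · have hout : outcome P A B = Outcome.balanced := by simp [outcome, hA, hB]
      have hunion : A ∪ B = Finset.univ.erase P.counterfeit := by
        ext i
        simp only [Finset.mem_union, Finset.mem_erase, Finset.mem_univ, and_true]
        constructor
        · rintro h rfl
          exact h.elim hA hB
        · intro hi
          have h1 := hall i hi
          have h3 := hd i
          by_contra hne
          simp only [weigh, updateStatus, hout, if_neg hne] at h1
          simp [h1] at h3
      have hcu := Finset.card_union_of_disjoint hAB
      rw [hunion, Finset.card_erase_of_mem (Finset.mem_univ _), Finset.card_univ,
        Fintype.card_fin] at hcu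
      have hpos : 0 < n := P.counterfeit.pos
      obtain ⟨m, hm⟩ := hn
      omega

/-- For `l, h ≥ 0` with `N = l + h ≥ 2` and `(l,h) ≠ (1,1)`,
the starting position of the normal-play destined-coins game `D_{l,h}` is a
P-position iff `N` is even, `min l h = 1`, and the counterfeit coin is the
unique coin of its destiny.  (Also, the one-coin position `N = 1` is a
P-position, being terminal.) -/
theorem normalP_destined {n l h : ℕ} (P : Position n)
    (hN : 2 ≤ l + h) (hlh : ¬ (l = 1 ∧ h = 1))
    (hl : (statusSet P CoinStatus.light).card = l)
    (hh : (statusSet P CoinStatus.heavy).card = h)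
    (hd : ∀ i, P.status i = CoinStatus.light ∨ P.status i = CoinStatus.heavy)
    (hcf : P.status P.counterfeit = P.fakeType.destiny) :
    (¬ NormalWin (GMove Found) P ↔
      Even (l + h) ∧ min l h = 1 ∧ sameDestinyCount P = 1) ∧
    (∀ P₁ : Position 1, P₁.status P₁.counterfeit = P₁.fakeType.destiny →
      ¬ NormalWin (GMove Found) P₁) := by
  have hcex : ∀ {m : ℕ} {Q : Position m}, Q.status Q.counterfeit = Q.fakeType.destiny →
      Q.status Q.counterfeit ≠ CoinStatus.excluded := by
    intro m Q hQ
    rw [hQ]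
    cases Q.fakeType <;> simp [FakeType.destiny]
  refine ⟨?_, fun P₁ hP₁ => not_normalWinAux_of_found
    ((found_iff (hcex hP₁)).2 fun i hi => absurd (Subsingleton.elim i _) hi) _⟩
  have hn : l + h = n := by
    have hdisj : Disjoint (statusSet P CoinStatus.light) (statusSet P CoinStatus.heavy) := by
      rw [Finset.disjoint_left]
      intro i hi hi'
      simp_all [statusSet]
    have hunion : statusSet P CoinStatus.light ∪ statusSet P CoinStatus.heavy = Finset.univ := by
      ext i
      simpa [statusSet] using hd i
    rw [← hl, ← hh, ← Finset.card_union_of_disjoint hdisj, hunion, Finset.card_univ,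
      Fintype.card_fin]
  have hinfo : info P = n := by
    have hone : ∀ i, statusWeight (P.status i) = 1 := fun i => by
      rcases hd i with hi | hi <;> rw [hi] <;> rfl
    simp [info, hone]
  have hnf : ¬ Found P := by
    rw [found_iff (hcex hcf)]
    intro hall
    have : Nontrivial (Fin n) := Fin.nontrivial_iff_two_le.2 (by omega)
    obtain ⟨i, hi⟩ := exists_ne P.counterfeit
    have hi' := hall i hi
    have := hd i
    simp_all
  have herase : (Finset.univ.erase P.counterfeit).card = n - 1 := by simp
  unfold NormalWin
  rw [hinfo]
  constructor
  · intro hlose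
    have heven : Even n := by
      by_contra hodd
      refine hlose (normalWinAux_of_even_card (S := Finset.univ.erase P.counterfeit)
        (by omega) hnf (hcex hcf) (by simp) ?_ fun i hi hiS => absurd (by simpa using hi) hiS)
      rw [herase]
      exact Nat.Odd.sub_odd (Nat.not_even_iff_odd.1 hodd) odd_one
    have hsame : sameDestinyCount P = 1 := by
      refine Finset.card_eq_one.2 ⟨P.counterfeit, Finset.eq_singleton_iff_unique_mem.2
        ⟨by simp, fun j hj => ?_⟩⟩
      by_contra hne
      exact hlose (normalWinAux_of_same_destiny (by omega) hnf hcf hne (by simpa using hj))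
    refine ⟨hn ▸ heven, ?_, hsame⟩
    have hlor : l = 1 ∨ h = 1 := by
      unfold sameDestinyCount at hsame
      unfold statusSet at hl hh
      rcases hd P.counterfeit with hc | hc <;> rw [hc] at hsame
      · exact Or.inl (hl.symm.trans hsame)
      · exact Or.inr (hh.symm.trans hsame)
    obtain ⟨m, hm⟩ := heven
    omega
  · rintro ⟨heven, -, hsame⟩ hwin
    rw [hn] at heven
    have huniq : ∀ i, i ≠ P.counterfeit → P.status i ≠ P.status P.counterfeit := by
      intro i hi hs
      have hle := Finset.card_le_one.1 (le_of_eq hsame)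
      exact hi (hle i (by simp [hs]) P.counterfeit (by simp))
    obtain ⟨k, rfl⟩ : ∃ k, n = k + 1 := ⟨n - 1, by omega⟩
    obtain ⟨Q, ⟨-, A, B, hAB, hcard, hne, rfl⟩, hQ⟩ := hwin
    obtain ⟨j, hj⟩ := Function.ne_iff.1 hne
    have hjex : (weigh P A B).status j = CoinStatus.excluded :=
      (updateStatus_eq_or_excluded P A B (hd j)).resolve_left hj
    have hcQ : (weigh P A B).status P.counterfeit ≠ CoinStatus.excluded :=
      hcex (Q := weigh P A B) (weigh_status_counterfeit hAB hcf)
    have hjc : j ≠ P.counterfeit := fun h => hcQ (h ▸ hjex)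
    refine hQ (normalWinAux_of_even_card
      (S := (Finset.univ.erase P.counterfeit).erase j) (by omega)
      (not_found_weigh hd hcf heven huniq hAB hcard) hcQ (by simp [weigh]) ?_ ?_)
    · rw [Finset.card_erase_of_mem (by simp [hjc]), herase]
      obtain ⟨m, hm⟩ := heven
      exact ⟨m - 1, by omega⟩
    · intro i hi hiS
      have hij : i = j := by
        by_contra hij
        exact hiS (Finset.mem_erase.2 ⟨hij, Finset.mem_erase.2 ⟨hi, Finset.mem_univ i⟩⟩)
      rw [hij, hjex]
end
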